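/- Given t ∈ ℕ and ε, μ > 0, there exists n₀ ∈ ℕ such that for every ε-wicked reduced hypergraph 𝒜 whose index set I has size at least n₀ there exist a set J ⊆ I of size t and two ε-disjoint (μ, 1/3+ε)-holes on J. -/

import Mathlib

open Finset Classical

noncomputable section

/-- A reduced hypergraph: a finite (linearly ordered, here `ℕ`) index set `I`,
pairwise disjoint nonempty finite vertex classes `P i j` for distinct `i j ∈ I`,
and for each triple of distinct indices a tripartite 3-uniform constituent,
encoded by a symmetric edge predicate on vertices. -/
structure ReducedHG where
  I : Finset ℕ
  P : ℕ → ℕ → Finset ℕ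
  Psymm : ∀ i j, P i j = P j i
  Pnonempty : ∀ i j, i ∈ I → j ∈ I → i ≠ j → (P i j).Nonempty
  Pdisjoint : ∀ i j k l, i ≠ j → k ≠ l → ({i, j} : Finset ℕ) ≠ ({k, l} : Finset ℕ) →
      Disjoint (P i j) (P k l)
  Edge : ℕ → ℕ → ℕ → Prop
  EdgeSymm : ∀ a b c, Edge a b c → Edge b a c
  EdgeSymm' : ∀ a b c, Edge a b c → Edge a c b
  EdgeValid : ∀ a b c, Edge a b c → ∃ i j k, i ∈ I ∧ j ∈ I ∧ k ∈ I ∧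
      i ≠ j ∧ i ≠ k ∧ j ≠ k ∧ a ∈ P i j ∧ b ∈ P i k ∧ c ∈ P j k

namespace ReducedHG

variable (A : ReducedHG)

/-- The neighbourhood, inside the vertex class `P j k`, of two vertices `a`, `b`. -/
def nbhd (j k : ℕ) (a b : ℕ) : Finset ℕ := (A.P j k).filter fun c => A.Edge a b c

/-- The number of crossing edges between three vertex sets. -/
def ecount (X Y Z : Finset ℕ) : ℕ :=
  ((X ×ˢ Y ×ˢ Z).filter fun t => A.Edge t.1 t.2.1 t.2.2).card

/-- `(d, ee)`-density: every pair of vertices sharing an index has large degree. -/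
def EEDense (d : ℝ) : Prop :=
  ∀ i j k, i ∈ A.I → j ∈ A.I → k ∈ A.I → i ≠ j → i ≠ k → j ≠ k →
    ∀ a ∈ A.P i j, ∀ b ∈ A.P i k,
      d * ((A.P j k).card : ℝ) ≤ ((A.nbhd j k a b).card : ℝ)

/-- `(μ, vvv)`-density: every constituent has many edges. -/
def VVVDense (μ : ℝ) : Prop :=
  ∀ i j k, i ∈ A.I → j ∈ A.I → k ∈ A.I → i ≠ j → i ≠ k → j ≠ k →
    μ * (((A.P i j).card : ℝ) * ((A.P i k).card : ℝ) * ((A.P j k).card : ℝ)) ≤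
      (A.ecount (A.P i j) (A.P i k) (A.P j k) : ℝ)

/-- The reduced hypergraph supports a `K₅⁽³⁾`. -/
def SupportsK5 : Prop :=
  ∃ J ⊆ A.I, J.card = 5 ∧ ∃ f : ℕ → ℕ → ℕ,
    (∀ i ∈ J, ∀ j ∈ J, f i j = f j i) ∧
    (∀ i ∈ J, ∀ j ∈ J, i ≠ j → f i j ∈ A.P i j) ∧
    (∀ i ∈ J, ∀ j ∈ J, ∀ k ∈ J, i ≠ j → i ≠ k → j ≠ k →
      A.Edge (f i j) (f i k) (f j k))

/-- `ε`-wicked: `(1/3 + ε, ee)`-dense and not supporting a `K₅⁽³⁾`. -/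
def Wicked (ε : ℝ) : Prop := A.EEDense (1/3 + ε) ∧ ¬ A.SupportsK5

/-- A `J`-transversal: one vertex in each class `P i j`, `ij ∈ J⁽²⁾`. -/
def IsTransversal (J : Finset ℕ) (Q : ℕ → ℕ → ℕ) : Prop :=
  (∀ i ∈ J, ∀ j ∈ J, Q i j = Q j i) ∧ ∀ i ∈ J, ∀ j ∈ J, i ≠ j → Q i j ∈ A.P i j

/-- A `(K, L)`-transversal: one vertex in each class `P k l`, `(k, l) ∈ K × L`. -/
def IsTransversal2 (K L : Finset ℕ) (Q : ℕ → ℕ → ℕ) : Prop :=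
  ∀ k ∈ K, ∀ l ∈ L, Q k l ∈ A.P k l

/-- An inhabited triple of `J`-transversals. -/
def InhabitedTriple (J : Finset ℕ) (Q R S : ℕ → ℕ → ℕ) : Prop :=
  ∀ i ∈ J, ∀ j ∈ J, ∀ k ∈ J, i < j → j < k → A.Edge (Q i j) (R i k) (S j k)

/-- An inhabited triple consisting of a `(K,L)`-, a `(K,M)`- and an `(L,M)`-transversal. -/
def InhabitedTriple2 (K L M : Finset ℕ) (Q R S : ℕ → ℕ → ℕ) : Prop :=
  ∀ k ∈ K, ∀ l ∈ L, ∀ m ∈ M, A.Edge (Q k l) (R k m) (S l m)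

/-- `Φ` is a `μ`-hole on `J`. -/
def IsHole (μ : ℝ) (J : Finset ℕ) (Φ : Finset ℕ) : Prop :=
  (∀ i ∈ J, ∀ j ∈ J, i ≠ j → (Φ ∩ A.P i j).Nonempty) ∧
  ∀ i ∈ J, ∀ j ∈ J, ∀ k ∈ J, i ≠ j → i ≠ k → j ≠ k →
    (A.ecount (Φ ∩ A.P i j) (Φ ∩ A.P i k) (Φ ∩ A.P j k) : ℝ) ≤
      μ * (((A.P i j).card : ℝ) * ((A.P i k).card : ℝ) * ((A.P j k).card : ℝ))

/-- `Φ` is a `(μ, ϑ)`-hole on `J` (a `μ`-hole of width at least `ϑ`). -/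
def IsHoleW (μ ϑ : ℝ) (J : Finset ℕ) (Φ : Finset ℕ) : Prop :=
  A.IsHole μ J Φ ∧ ∀ i ∈ J, ∀ j ∈ J, i ≠ j →
    ϑ * ((A.P i j).card : ℝ) ≤ (((Φ ∩ A.P i j)).card : ℝ)

/-- Two holes are `ε`-intersecting on `J`. -/
def HolesIntersecting (ε : ℝ) (J : Finset ℕ) (Φ Ψ : Finset ℕ) : Prop :=
  ∀ i ∈ J, ∀ j ∈ J, i ≠ j →
    ε * ((A.P i j).card : ℝ) ≤ ((Φ ∩ Ψ ∩ A.P i j).card : ℝ)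

/-- Two holes are `ε`-disjoint on `J`. -/
def HolesDisjoint (ε : ℝ) (J : Finset ℕ) (Φ Ψ : Finset ℕ) : Prop :=
  ∀ i ∈ J, ∀ j ∈ J, i ≠ j →
    ((Φ ∩ Ψ ∩ A.P i j).card : ℝ) < ε * ((A.P i j).card : ℝ)

/-- The link on `K` of the family `k ↦ f k`, where `f k` is a vertex in a class `P k ·`:
`⋃_{k ≠ k' ∈ K} N(f k, f k')`. -/
def link (K : Finset ℕ) (f : ℕ → ℕ) : Finset ℕ :=
  ((K ×ˢ K).filter fun p => p.1 ≠ p.2).biUnion fun p => A.nbhd p.1 p.2 (f p.1) (f p.2)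

/-- The pair consisting of a transversal `T` on `Sh × B` and a transversal `U` on `Sh × C`
has `δ`-intersecting links. -/
def IntersectingLinks (δ : ℝ) (Sh B C : Finset ℕ) (T U : ℕ → ℕ → ℕ) : Prop :=
  ∀ a ∈ Sh, ∀ a' ∈ Sh, a ≠ a' → ∀ b ∈ B, ∀ c ∈ C,
    δ * ((A.P a a').card : ℝ) ≤
      (((A.nbhd a a' (T a b) (T a' b)) ∩ (A.nbhd a a' (U a c) (U a' c))).card : ℝ)

/-- The pair consisting of a transversal `T` on `Sh × B` and a transversal `U` on `Sh × C`
has `δ`-disjoint links. -/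
def DisjointLinks (δ : ℝ) (Sh B C : Finset ℕ) (T U : ℕ → ℕ → ℕ) : Prop :=
  ∀ a ∈ Sh, ∀ a' ∈ Sh, a ≠ a' → ∀ b ∈ B, ∀ c ∈ C,
    (((A.nbhd a a' (T a b) (T a' b)) ∩ (A.nbhd a a' (U a c) (U a' c))).card : ℝ) <
      δ * ((A.P a a').card : ℝ)

/-- A bicolouring of the reduced hypergraph: both colours appear in every vertex class and
no edge is monochromatic. -/
def IsBicolouring (φ : ℕ → Bool) : Prop :=
  (∀ i ∈ A.I, ∀ j ∈ A.I, i ≠ j →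
    (∃ v ∈ A.P i j, φ v = true) ∧ (∃ v ∈ A.P i j, φ v = false)) ∧
  ∀ a b c, A.Edge a b c → ¬ (φ a = φ b ∧ φ b = φ c)

/-- The minimum monochromatic codegree density is at least `x`: `τ₂(A, φ) ≥ x`. -/
def Tau2Ge (φ : ℕ → Bool) (x : ℝ) : Prop :=
  ∀ i j k, i ∈ A.I → j ∈ A.I → k ∈ A.I → i ≠ j → i ≠ k → j ≠ k →
    ∀ a ∈ A.P i j, ∀ b ∈ A.P i k, φ a = φ b →
      x * ((A.P j k).card : ℝ) ≤ ((A.nbhd j k a b).card : ℝ)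

/-- The `γ`-bad left cherries (both vertices in one hole, many neighbours outside
the other hole). -/
def badLeft (Φ Ψ : Finset ℕ) (γ : ℝ) (i j k : ℕ) : Finset (ℕ × ℕ) :=
  (A.P i j ×ˢ A.P i k).filter fun p =>
    (p.1 ∈ Φ ∧ p.2 ∈ Φ ∧ γ * ((A.P j k).card : ℝ) ≤ (((A.nbhd j k p.1 p.2) \ Ψ).card : ℝ)) ∨
    (p.1 ∈ Ψ ∧ p.2 ∈ Ψ ∧ γ * ((A.P j k).card : ℝ) ≤ (((A.nbhd j k p.1 p.2) \ Φ).card : ℝ))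

/-- The `γ`-bad middle cherries. -/
def badMid (Φ Ψ : Finset ℕ) (γ : ℝ) (i j k : ℕ) : Finset (ℕ × ℕ) :=
  (A.P i j ×ˢ A.P j k).filter fun p =>
    (p.1 ∈ Φ ∧ p.2 ∈ Φ ∧ γ * ((A.P i k).card : ℝ) ≤ (((A.nbhd i k p.1 p.2) \ Ψ).card : ℝ)) ∨
    (p.1 ∈ Ψ ∧ p.2 ∈ Ψ ∧ γ * ((A.P i k).card : ℝ) ≤ (((A.nbhd i k p.1 p.2) \ Φ).card : ℝ))

/-- The `γ`-bad right cherries. -/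
def badRight (Φ Ψ : Finset ℕ) (γ : ℝ) (i j k : ℕ) : Finset (ℕ × ℕ) :=
  (A.P i k ×ˢ A.P j k).filter fun p =>
    (p.1 ∈ Φ ∧ p.2 ∈ Φ ∧ γ * ((A.P i j).card : ℝ) ≤ (((A.nbhd i j p.1 p.2) \ Ψ).card : ℝ)) ∨
    (p.1 ∈ Ψ ∧ p.2 ∈ Ψ ∧ γ * ((A.P i j).card : ℝ) ≤ (((A.nbhd i j p.1 p.2) \ Φ).card : ℝ))

end ReducedHG

lemma union_sel {ι : Type} [Fintype ι] (V : ι → Finset ℕ)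
    (hV : ∀ a, (V a).Nonempty) (Bad : ι → ι → ℕ → ℕ → Prop) (η : ℝ)
    (hB : ∀ a b, a ≠ b → ((((V a) ×ˢ (V b)).filter fun p => Bad a b p.1 p.2).card : ℝ) ≤
      η * (((V a).card : ℝ) * ((V b).card : ℝ))) (hη0 : 0 ≤ η)
    (hη : (Fintype.card ι : ℝ) ^ 2 * η < 1) :
    ∃ f : ι → ℕ, (∀ a, f a ∈ V a) ∧ ∀ a b, a ≠ b → ¬ Bad a b (f a) (f b) := by
  choose v0 hv0 using hV
  have hpos : 0 < ((Fintype.piFinset V).card : ℝ) := by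
    have : v0 ∈ Fintype.piFinset V := by simpa [Fintype.mem_piFinset] using hv0
    exact_mod_cast Finset.card_pos.mpr ⟨v0, this⟩
  have key : ∀ a b, a ≠ b →
      (((Fintype.piFinset V).filter fun f => Bad a b (f a) (f b)).card : ℝ) ≤
        η * ((Fintype.piFinset V).card : ℝ) := by
    intro a b hab
    set R := (Fintype.piFinset V).filter fun f => f a = v0 a ∧ f b = v0 b with hR
    have h1 : ((Fintype.piFinset V).filter fun f => Bad a b (f a) (f b)).card ≤
        ((((V a) ×ˢ (V b)).filter fun p => Bad a b p.1 p.2) ×ˢ R).card := by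
      apply Finset.card_le_card_of_injOn
        (fun f => ((f a, f b), Function.update (Function.update f a (v0 a)) b (v0 b)))
      · intro f hf
        simp only [coe_filter, Fintype.mem_piFinset, Set.mem_ofPred_eq] at hf
        simp only [coe_product, Set.mem_prod, mem_coe, mem_filter, mem_product, hR,
          Fintype.mem_piFinset]
        refine ⟨⟨⟨hf.1 a, hf.1 b⟩, hf.2⟩, ?_, ?_, ?_⟩
        · intro c
          by_cases hcb : c = b
          · subst hcb; simpa using hv0 c
          · by_cases hca : c = a
            · subst hca; simpa [Function.update_of_ne hcb] using hv0 c
            · simpa [Function.update_of_ne hcb, Function.update_of_ne hca] using hf.1 c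
        · simp [Function.update_of_ne hab]
        · simp
      · intro f _ g _ hfg
        simp only [Prod.mk.injEq] at hfg
        obtain ⟨⟨ha, hb⟩, hc⟩ := hfg
        funext c
        by_cases hcb : c = b
        · subst hcb; exact hb
        · by_cases hca : c = a
          · subst hca; exact ha
          · simpa [Function.update_of_ne hcb, Function.update_of_ne hca] using congrFun hc c
    have h2 : (((V a) ×ˢ (V b)) ×ˢ R).card ≤ (Fintype.piFinset V).card := by
      apply Finset.card_le_card_of_injOn
        (fun q => Function.update (Function.update q.2 a q.1.1) b q.1.2)
      · rintro ⟨⟨x, y⟩, f⟩ hf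
        simp only [coe_product, Set.mem_prod, mem_coe, mem_filter, hR,
          Fintype.mem_piFinset] at hf
        simp only [mem_coe, Fintype.mem_piFinset]
        intro c
        by_cases hcb : c = b
        · subst hcb; simpa using hf.1.2
        · by_cases hca : c = a
          · subst hca; simpa [Function.update_of_ne hcb] using hf.1.1
          · simpa [Function.update_of_ne hcb, Function.update_of_ne hca] using hf.2.1 c
      · rintro ⟨⟨x, y⟩, f⟩ hf ⟨⟨x', y'⟩, f'⟩ hf' h
        simp only [coe_product, Set.mem_prod, mem_coe, mem_filter, hR,
          Fintype.mem_piFinset] at hf hf'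
        dsimp only at h
        have hx := congrFun h a
        have hy := congrFun h b
        simp [Function.update_of_ne hab] at hx hy
        have hff : f = f' := by
          funext c
          by_cases hcb : c = b
          · subst hcb; rw [hf.2.2.2, hf'.2.2.2]
          · by_cases hca : c = a
            · subst hca; rw [hf.2.2.1, hf'.2.2.1]
            · simpa [Function.update_of_ne hcb, Function.update_of_ne hca] using congrFun h c
        rw [hx, hy, hff]
    rw [card_product] at h1 h2
    rw [card_product] at h2
    have h1' : (((Fintype.piFinset V).filter fun f => Bad a b (f a) (f b)).card : ℝ) ≤
      ((((V a) ×ˢ (V b)).filter fun p => Bad a b p.1 p.2).card : ℝ) * (R.card : ℝ) := by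
      exact_mod_cast h1
    have h2' : ((V a).card : ℝ) * ((V b).card : ℝ) * (R.card : ℝ) ≤
      ((Fintype.piFinset V).card : ℝ) := by exact_mod_cast h2
    calc _ ≤ _ := h1'
      _ ≤ (η * (((V a).card : ℝ) * ((V b).card : ℝ))) * (R.card : ℝ) := by
        gcongr; exact hB a b hab
      _ = η * (((V a).card : ℝ) * ((V b).card : ℝ) * (R.card : ℝ)) := by ring
      _ ≤ _ := by gcongr
  by_contra hcon
  push Not at hcon
  have hsub : Fintype.piFinset V ⊆ ((Finset.univ : Finset (ι × ι)).filter
      fun p => p.1 ≠ p.2).biUnion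
      fun p => (Fintype.piFinset V).filter fun f => Bad p.1 p.2 (f p.1) (f p.2) := by
    intro f hf
    obtain ⟨a, b, hab, h⟩ := hcon f (by simpa [Fintype.mem_piFinset] using hf)
    simp only [mem_biUnion, mem_filter, mem_univ, true_and]
    exact ⟨(a, b), hab, hf, h⟩
  have hc : ((Fintype.piFinset V).card : ℝ) ≤ ∑ p ∈ ((Finset.univ : Finset (ι × ι)).filter
      fun p => p.1 ≠ p.2),
      (((Fintype.piFinset V).filter fun f => Bad p.1 p.2 (f p.1) (f p.2)).card : ℝ) := by
    exact_mod_cast (Finset.card_le_card hsub).trans Finset.card_biUnion_le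
  have hc2 := hc.trans (Finset.sum_le_sum fun p hp => key p.1 p.2 (Finset.mem_filter.mp hp).2)
  rw [Finset.sum_const, nsmul_eq_mul] at hc2
  have hcard : ((((Finset.univ : Finset (ι × ι)).filter fun p => p.1 ≠ p.2).card : ℕ) : ℝ) ≤
      (Fintype.card ι : ℝ) ^ 2 := by
    have := Finset.card_filter_le (Finset.univ : Finset (ι × ι)) (fun p => p.1 ≠ p.2)
    rw [Finset.card_univ, Fintype.card_prod, ← sq] at this
    exact_mod_cast this
  have h3 := mul_le_mul_of_nonneg_right hcard
    (mul_nonneg hη0 hpos.le)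
  nlinarith

namespace ReducedHG

lemma mem_nbhd {A : ReducedHG} {j k a b c : ℕ} :
    c ∈ A.nbhd j k a b ↔ c ∈ A.P j k ∧ A.Edge a b c := by
  simp [nbhd]

lemma nbhd_symm (A : ReducedHG) (j k a b : ℕ) : A.nbhd j k a b = A.nbhd k j b a := by
  ext c
  rw [mem_nbhd, mem_nbhd, A.Psymm j k]
  exact and_congr_right fun _ => ⟨A.EdgeSymm _ _ _, A.EdgeSymm _ _ _⟩

lemma link_inter (A : ReducedHG) (S : Finset ℕ) (f : ℕ → ℕ) {i j : ℕ} (hi : i ∈ S) (hj : j ∈ S)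
    (hij : i ≠ j) : A.link S f ∩ A.P i j = A.nbhd i j (f i) (f j) := by
  ext c
  simp only [link, mem_inter, mem_biUnion, mem_filter, mem_product, Prod.exists]
  constructor
  · rintro ⟨⟨k, l, ⟨⟨hk, hl⟩, hkl⟩, hc⟩, hcP⟩
    by_cases h : ({i, j} : Finset ℕ) = {k, l}
    · have hki : k ∈ ({i, j} : Finset ℕ) := by rw [h]; simp
      have hli : l ∈ ({i, j} : Finset ℕ) := by rw [h]; simp
      simp only [mem_insert, mem_singleton] at hki hli
      rcases hki with rfl | rfl <;> rcases hli with rfl | rfl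
      · exact absurd rfl hkl
      · exact hc
      · rw [nbhd_symm]; exact hc
      · exact absurd rfl hkl
    · exact absurd (mem_nbhd.mp hc).1
        (Finset.disjoint_left.mp (A.Pdisjoint i j k l hij hkl h) hcP)
  · intro hc
    exact ⟨⟨i, j, ⟨⟨hi, hj⟩, hij⟩, hc⟩, (mem_nbhd.mp hc).1⟩

lemma shrink_one {A : ReducedHG} {ε : ℝ} (hε : 0 < ε) (hA : A.EEDense (1/3 + ε))
    (T : ℕ → ℕ → ℕ) {b b' : ℕ} (hb : b ∈ A.I) (hb' : b' ∈ A.I) (hbb : b ≠ b')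
    (S : Finset ℕ) (hS : S ⊆ A.I) (hSb : b ∉ S) (hSb' : b' ∉ S)
    (hT : ∀ a ∈ S, T a b ∈ A.P a b) (hT' : ∀ a ∈ S, T a b' ∈ A.P a b') :
    ∃ S' ⊆ S, S.card ≤ 3 * S'.card ∧
      ∃ Q ∈ A.P b b', ∀ a ∈ S', A.Edge (T a b) (T a b') Q := by
  have hne := A.Pnonempty b b' hb hb' hbb
  have hdeg : ∀ a ∈ S, (1/3 : ℝ) * ((A.P b b').card : ℝ) ≤
      ((A.nbhd b b' (T a b) (T a b')).card : ℝ) := by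
    intro a ha
    have h := hA a b b' (hS ha) hb hb' (fun h => hSb (h ▸ ha)) (fun h => hSb' (h ▸ ha)) hbb
      _ (hT a ha) _ (hT' a ha)
    have : (0:ℝ) ≤ ε * ((A.P b b').card : ℝ) := by positivity
    linarith
  have hsum : ∑ a ∈ S, (A.nbhd b b' (T a b) (T a b')).card =
      ∑ Q ∈ A.P b b', (S.filter fun a => A.Edge (T a b) (T a b') Q).card :=
    Finset.sum_card_bipartiteAbove_eq_sum_card_bipartiteBelow
      (r := fun a Q => A.Edge (T a b) (T a b') Q)
  have hle : ∑ Q ∈ A.P b b', ((S.card : ℝ) / 3) ≤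
      ∑ Q ∈ A.P b b', ((S.filter fun a => A.Edge (T a b) (T a b') Q).card : ℝ) := by
    have h1 := Finset.sum_le_sum hdeg
    have h2 : ∑ a ∈ S, ((A.nbhd b b' (T a b) (T a b')).card : ℝ) =
      ∑ Q ∈ A.P b b', ((S.filter fun a => A.Edge (T a b) (T a b') Q).card : ℝ) := by
      exact_mod_cast hsum
    rw [← h2]
    refine le_trans (le_of_eq ?_) h1
    simp only [Finset.sum_const, nsmul_eq_mul]
    ring
  obtain ⟨Q, hQ, h⟩ := Finset.exists_le_of_sum_le hne hle
  refine ⟨_, Finset.filter_subset _ _, ?_, Q, hQ, fun a ha => (Finset.mem_filter.mp ha).2⟩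
  have : (S.card : ℝ) ≤ 3 * ((S.filter fun a => A.Edge (T a b) (T a b') Q).card : ℝ) := by
    linarith
  exact_mod_cast this

lemma shrink_all {A : ReducedHG} {ε : ℝ} (hε : 0 < ε) (hA : A.EEDense (1/3 + ε))
    (T : ℕ → ℕ → ℕ) (B : Finset ℕ) (hB : B ⊆ A.I)
    (F : Finset (ℕ × ℕ)) (hF : ∀ p ∈ F, p.1 ∈ B ∧ p.2 ∈ B ∧ p.1 ≠ p.2) (n : ℕ) :
    ∀ (S : Finset ℕ), S ⊆ A.I → Disjoint S B →
    (∀ a ∈ S, ∀ b ∈ B, T a b ∈ A.P a b) → 3 ^ F.card * n ≤ S.card →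
    ∃ S' ⊆ S, n ≤ S'.card ∧ ∀ p ∈ F,
      ∃ Q ∈ A.P p.1 p.2, ∀ a ∈ S', A.Edge (T a p.1) (T a p.2) Q := by
  induction F using Finset.induction_on with
  | empty =>
    intro S _ _ _ hn
    exact ⟨S, Finset.Subset.refl _, by simpa using hn, by simp⟩
  | insert p F hp ih =>
    intro S hS hSB hT hn
    obtain ⟨hp1, hp2, hp3⟩ := hF p (Finset.mem_insert_self _ _)
    obtain ⟨S1, hS1, hc1, Q, hQ, hE⟩ := shrink_one hε hA T (hB hp1) (hB hp2) hp3 S hS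
      (Finset.disjoint_right.mp hSB hp1) (Finset.disjoint_right.mp hSB hp2)
      (fun a ha => hT a ha _ hp1) (fun a ha => hT a ha _ hp2)
    rw [Finset.card_insert_of_notMem hp, pow_succ] at hn
    obtain ⟨S2, hS2, hc2, h⟩ := ih (fun q hq => hF q (Finset.mem_insert_of_mem hq)) S1
      (hS1.trans hS) (Finset.disjoint_of_subset_left hS1 hSB)
      (fun a ha => hT a (hS1 ha)) (by nlinarith)
    refine ⟨S2, hS2.trans hS1, hc2, ?_⟩
    intro q hq
    rcases Finset.mem_insert.mp hq with rfl | hq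
    · exact ⟨Q, hQ, fun a ha => hE a (hS2 ha)⟩
    · exact h q hq

set_option linter.unusedSimpArgs false in
lemma k5_of {A : ReducedHG} (T : ℕ → ℕ → ℕ) {i j k b b' x y z Q : ℕ}
    (hi : i ∈ A.I) (hj : j ∈ A.I) (hk : k ∈ A.I) (hb : b ∈ A.I) (hb' : b' ∈ A.I)
    (hij : i ≠ j) (hik : i ≠ k) (hjk : j ≠ k) (hbb : b ≠ b')
    (hib : i ≠ b) (hib' : i ≠ b') (hjb : j ≠ b) (hjb' : j ≠ b') (hkb : k ≠ b) (hkb' : k ≠ b')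
    (hTi : T i b ∈ A.P i b) (hTj : T j b ∈ A.P j b) (hTk : T k b ∈ A.P k b)
    (hTi' : T i b' ∈ A.P i b') (hTj' : T j b' ∈ A.P j b') (hTk' : T k b' ∈ A.P k b')
    (hQ : Q ∈ A.P b b')
    (hQi : A.Edge (T i b) (T i b') Q) (hQj : A.Edge (T j b) (T j b') Q)
    (hQk : A.Edge (T k b) (T k b') Q)
    (hx : x ∈ A.nbhd i j (T i b) (T j b)) (hx' : x ∈ A.nbhd i j (T i b') (T j b'))
    (hy : y ∈ A.nbhd i k (T i b) (T k b)) (hy' : y ∈ A.nbhd i k (T i b') (T k b'))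
    (hz : z ∈ A.nbhd j k (T j b) (T k b)) (hz' : z ∈ A.nbhd j k (T j b') (T k b'))
    (he : A.Edge x y z) : A.SupportsK5 := by
  rw [mem_nbhd] at hx hx' hy hy' hz hz'
  have s1 := A.EdgeSymm
  have s2 := A.EdgeSymm'
  have sP := A.Psymm
  let g : ℕ → ℕ → ℕ := fun p q =>
    if p = i ∧ q = j then x else if p = i ∧ q = k then y else if p = j ∧ q = k then z else
    if p = i ∧ q = b then T i b else if p = j ∧ q = b then T j b else
    if p = k ∧ q = b then T k b else
    if p = i ∧ q = b' then T i b' else if p = j ∧ q = b' then T j b' else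
    if p = k ∧ q = b' then T k b' else if p = b ∧ q = b' then Q else 0
  let f : ℕ → ℕ → ℕ := fun p q => max (g p q) (g q p)
  have fs : ∀ p q, f p q = f q p := fun p q => max_comm _ _
  have e0 : f i j = x := by
    simp [f, g, hij, hik, hjk, hbb, hib, hib', hjb, hjb', hkb, hkb', hij.symm, hik.symm, hjk.symm,
      hbb.symm, hib.symm, hib'.symm, hjb.symm, hjb'.symm, hkb.symm, hkb'.symm]
  have e1 : f i k = y := by
    simp [f, g, hij, hik, hjk, hbb, hib, hib', hjb, hjb', hkb, hkb', hij.symm, hik.symm, hjk.symm,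
      hbb.symm, hib.symm, hib'.symm, hjb.symm, hjb'.symm, hkb.symm, hkb'.symm]
  have e2 : f j k = z := by
    simp [f, g, hij, hik, hjk, hbb, hib, hib', hjb, hjb', hkb, hkb', hij.symm, hik.symm, hjk.symm,
      hbb.symm, hib.symm, hib'.symm, hjb.symm, hjb'.symm, hkb.symm, hkb'.symm]
  have e3 : f i b = T i b := by
    simp [f, g, hij, hik, hjk, hbb, hib, hib', hjb, hjb', hkb, hkb', hij.symm, hik.symm, hjk.symm,
      hbb.symm, hib.symm, hib'.symm, hjb.symm, hjb'.symm, hkb.symm, hkb'.symm]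
  have e4 : f j b = T j b := by
    simp [f, g, hij, hik, hjk, hbb, hib, hib', hjb, hjb', hkb, hkb', hij.symm, hik.symm, hjk.symm,
      hbb.symm, hib.symm, hib'.symm, hjb.symm, hjb'.symm, hkb.symm, hkb'.symm]
  have e5 : f k b = T k b := by
    simp [f, g, hij, hik, hjk, hbb, hib, hib', hjb, hjb', hkb, hkb', hij.symm, hik.symm, hjk.symm,
      hbb.symm, hib.symm, hib'.symm, hjb.symm, hjb'.symm, hkb.symm, hkb'.symm]
  have e6 : f i b' = T i b' := by
    simp [f, g, hij, hik, hjk, hbb, hib, hib', hjb, hjb', hkb, hkb', hij.symm, hik.symm, hjk.symm,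
      hbb.symm, hib.symm, hib'.symm, hjb.symm, hjb'.symm, hkb.symm, hkb'.symm]
  have e7 : f j b' = T j b' := by
    simp [f, g, hij, hik, hjk, hbb, hib, hib', hjb, hjb', hkb, hkb', hij.symm, hik.symm, hjk.symm,
      hbb.symm, hib.symm, hib'.symm, hjb.symm, hjb'.symm, hkb.symm, hkb'.symm]
  have e8 : f k b' = T k b' := by
    simp [f, g, hij, hik, hjk, hbb, hib, hib', hjb, hjb', hkb, hkb', hij.symm, hik.symm, hjk.symm,
      hbb.symm, hib.symm, hib'.symm, hjb.symm, hjb'.symm, hkb.symm, hkb'.symm]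
  have e9 : f b b' = Q := by
    simp [f, g, hij, hik, hjk, hbb, hib, hib', hjb, hjb', hkb, hkb', hij.symm, hik.symm, hjk.symm,
      hbb.symm, hib.symm, hib'.symm, hjb.symm, hjb'.symm, hkb.symm, hkb'.symm]
  have e0s : f j i = x := (fs _ _).trans e0
  have e1s : f k i = y := (fs _ _).trans e1
  have e2s : f k j = z := (fs _ _).trans e2
  have e3s : f b i = T i b := (fs _ _).trans e3
  have e4s : f b j = T j b := (fs _ _).trans e4
  have e5s : f b k = T k b := (fs _ _).trans e5
  have e6s : f b' i = T i b' := (fs _ _).trans e6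
  have e7s : f b' j = T j b' := (fs _ _).trans e7
  have e8s : f b' k = T k b' := (fs _ _).trans e8
  have e9s : f b' b = Q := (fs _ _).trans e9
  clear_value f
  have all6 : ∀ a b c, A.Edge a b c → A.Edge a b c ∧ A.Edge a c b ∧ A.Edge b a c ∧ A.Edge b c a ∧
      A.Edge c a b ∧ A.Edge c b a := fun a b c h =>
    ⟨h, s2 _ _ _ h, s1 _ _ _ h, s2 _ _ _ (s1 _ _ _ h), s1 _ _ _ (s2 _ _ _ h),
      s1 _ _ _ (s2 _ _ _ (s1 _ _ _ h))⟩
  have d1 := all6 _ _ _ he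
  have d2 := all6 _ _ _ hQi
  have d3 := all6 _ _ _ hQj
  have d4 := all6 _ _ _ hQk
  have d5 := all6 _ _ _ hx.2
  have d6 := all6 _ _ _ hx'.2
  have d7 := all6 _ _ _ hy.2
  have d8 := all6 _ _ _ hy'.2
  have d9 := all6 _ _ _ hz.2
  have d10 := all6 _ _ _ hz'.2
  have hxP := hx.1
  have hyP := hy.1
  have hzP := hz.1
  refine ⟨{i, j, k, b, b'}, ?_, ?_, f, fun p _ q _ => fs p q, ?_, ?_⟩
  · intro p hp
    simp only [mem_insert, mem_singleton] at hp
    rcases hp with h | h | h | h | h <;> rw [h] <;> assumption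
  · simp [hij, hik, hjk, hbb, hib, hib', hjb, hjb', hkb, hkb']
  · intro p hp q hq hpq
    simp only [mem_insert, mem_singleton] at hp hq
    rcases hp with h | h | h | h | h <;> rcases hq with h' | h' | h' | h' | h' <;>
      first
      | exact absurd (h.trans h'.symm) hpq
      | (rw [h, h']
         simp only [e0, e0s, e1, e1s, e2, e2s, e3, e3s, e4, e4s, e5, e5s, e6, e6s, e7, e7s, e8, e8s, e9, e9s]
         first | assumption | (rw [A.Psymm]; assumption))
  · intro p hp q hq r hr hpq hpr hqr
    simp only [mem_insert, mem_singleton] at hp hq hr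
    rcases hp with h | h | h | h | h <;> rcases hq with h' | h' | h' | h' | h' <;>
      first
      | exact absurd (h.trans h'.symm) hpq
      | (rcases hr with h'' | h'' | h'' | h'' | h'' <;>
        first
        | exact absurd (h.trans h''.symm) hpr
        | exact absurd (h'.trans h''.symm) hqr
        | (rw [h, h', h'']
           simp only [e0, e0s, e1, e1s, e2, e2s, e3, e3s, e4, e4s, e5, e5s, e6, e6s, e7, e7s, e8, e8s, e9, e9s, d1, d2, d3, d4, d5, d6, d7, d8, d9, d10]))

/-- Main lemma. -/
lemma main_lemma (t : ℕ) (μ : ℝ) (hμ : 0 < μ) : ∃ m n : ℕ, ∀ (A : ReducedHG) (ε : ℝ), 0 < ε →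
    A.Wicked ε → ∀ S B : Finset ℕ, S ⊆ A.I → B ⊆ A.I → Disjoint S B → B.card = m →
    n ≤ S.card → ∀ T : ℕ → ℕ → ℕ, (∀ a ∈ S, ∀ b ∈ B, T a b ∈ A.P a b) →
    ∃ b ∈ B, ∃ S' ⊆ S, S'.card = t ∧ ∀ i ∈ S', ∀ j ∈ S', ∀ k ∈ S', i ≠ j → i ≠ k → j ≠ k →
      (A.ecount (A.nbhd i j (T i b) (T j b)) (A.nbhd i k (T i b) (T k b))
        (A.nbhd j k (T j b) (T k b)) : ℝ) ≤
      μ * (((A.P i j).card : ℝ) * ((A.P i k).card : ℝ) * ((A.P j k).card : ℝ)) := by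
  obtain ⟨m, hm⟩ := exists_nat_gt ((t : ℝ)^3 / μ)
  refine ⟨m, 3 ^ (m * m) * t, ?_⟩
  intro A ε hε hA S B hS hB hSB hBm hSn T hT
  have hm0 : 0 < m := by
    have : (0:ℝ) < m := lt_of_le_of_lt (by positivity) hm
    exact_mod_cast this
  set F := (B ×ˢ B).filter fun p => p.1 ≠ p.2 with hF
  have hFc : F.card ≤ m * m := by
    refine (Finset.card_filter_le _ _).trans ?_
    rw [Finset.card_product, hBm]
  obtain ⟨S1, hS1, hc1, hQ⟩ := shrink_all hε hA.1 T B hB F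
    (by intro p hp; simp only [hF, mem_filter, mem_product] at hp; tauto) t S hS hSB hT
    (le_trans (Nat.mul_le_mul_right _ (Nat.pow_le_pow_right (by norm_num) hFc)) hSn)
  obtain ⟨S', hS', hct⟩ := Finset.exists_subset_card_eq hc1
  have hSS : S' ⊆ S := hS'.trans hS1
  let w : ℕ × ℕ × ℕ → ℝ := fun q =>
    ((A.P q.1 q.2.1).card : ℝ) * ((A.P q.1 q.2.2).card : ℝ) * ((A.P q.2.1 q.2.2).card : ℝ)
  let E : ℕ → ℕ × ℕ × ℕ → Finset (ℕ × ℕ × ℕ) := fun b q =>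
    (A.nbhd q.1 q.2.1 (T q.1 b) (T q.2.1 b) ×ˢ A.nbhd q.1 q.2.2 (T q.1 b) (T q.2.2 b) ×ˢ
      A.nbhd q.2.1 q.2.2 (T q.2.1 b) (T q.2.2 b)).filter fun t => A.Edge t.1 t.2.1 t.2.2
  let Tr := (S' ×ˢ S' ×ˢ S').filter fun q => q.1 ≠ q.2.1 ∧ q.1 ≠ q.2.2 ∧ q.2.1 ≠ q.2.2
  have hTrm : ∀ q ∈ Tr, q.1 ∈ S' ∧ q.2.1 ∈ S' ∧ q.2.2 ∈ S' ∧
      q.1 ≠ q.2.1 ∧ q.1 ≠ q.2.2 ∧ q.2.1 ≠ q.2.2 := by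
    intro q hq
    simp only [Tr, mem_filter, mem_product] at hq
    tauto
  have hw : ∀ q ∈ Tr, 0 < w q := by
    intro q hq
    obtain ⟨h1, h2, h3, h4, h5, h6⟩ := hTrm q hq
    have p1 := Finset.card_pos.mpr (A.Pnonempty _ _ (hS (hSS h1)) (hS (hSS h2)) h4)
    have p2 := Finset.card_pos.mpr (A.Pnonempty _ _ (hS (hSS h1)) (hS (hSS h3)) h5)
    have p3 := Finset.card_pos.mpr (A.Pnonempty _ _ (hS (hSS h2)) (hS (hSS h3)) h6)
    simp only [w]
    positivity
  have hdisj : ∀ q ∈ Tr, ∑ b ∈ B, ((E b q).card : ℝ) ≤ w q := by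
    intro q hq
    obtain ⟨h1, h2, h3, h4, h5, h6⟩ := hTrm q hq
    have hpd : (B : Set ℕ).PairwiseDisjoint fun b => E b q := by
      intro b hb b' hb' hbb
      rw [Function.onFun, Finset.disjoint_left]
      rintro ⟨x, y, z⟩ hx hx'
      simp only [E, mem_filter, mem_product] at hx hx'
      have hbm : b ∈ B := hb
      have hbm' : b' ∈ B := hb'
      obtain ⟨Q, hQP, hQE⟩ := hQ (b, b') (by simp [hF, hbm, hbm', hbb])
      have ne : ∀ i ∈ S', ∀ c ∈ B, i ≠ c := fun i hi c hc h =>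
        Finset.disjoint_left.mp hSB (hSS hi) (h ▸ hc)
      exact hA.2 (k5_of T (hS (hSS h1)) (hS (hSS h2)) (hS (hSS h3)) (hB hbm) (hB hbm') h4 h5 h6 hbb
        (ne _ h1 _ hbm) (ne _ h1 _ hbm') (ne _ h2 _ hbm) (ne _ h2 _ hbm') (ne _ h3 _ hbm)
        (ne _ h3 _ hbm')
        (hT _ (hSS h1) _ hbm) (hT _ (hSS h2) _ hbm) (hT _ (hSS h3) _ hbm)
        (hT _ (hSS h1) _ hbm') (hT _ (hSS h2) _ hbm') (hT _ (hSS h3) _ hbm')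
        hQP (hQE _ (hS' h1)) (hQE _ (hS' h2)) (hQE _ (hS' h3))
        hx.1.1 hx'.1.1 hx.1.2.1 hx'.1.2.1 hx.1.2.2 hx'.1.2.2 hx.2)
    have hsub : B.biUnion (fun b => E b q) ⊆ A.P q.1 q.2.1 ×ˢ A.P q.1 q.2.2 ×ˢ A.P q.2.1 q.2.2 := by
      intro r hr
      simp only [E, mem_biUnion, mem_filter, mem_product, mem_nbhd] at hr
      simp only [mem_product]
      tauto
    have := Finset.card_le_card hsub
    rw [Finset.card_biUnion hpd, Finset.card_product, Finset.card_product] at this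
    have h' : ∑ b ∈ B, ((E b q).card : ℝ) ≤ ((A.P q.1 q.2.1).card : ℝ) *
      (((A.P q.1 q.2.2).card : ℝ) * ((A.P q.2.1 q.2.2).card : ℝ)) := by exact_mod_cast this
    simp only [w]
    linarith
  have htot : ∑ b ∈ B, ∑ q ∈ Tr, ((E b q).card : ℝ) / w q ≤ ∑ b ∈ B, μ := by
    rw [Finset.sum_comm]
    have h1 : ∑ q ∈ Tr, ∑ b ∈ B, ((E b q).card : ℝ) / w q ≤ ∑ q ∈ Tr, (1 : ℝ) := by
      apply Finset.sum_le_sum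
      intro q hq
      rw [← Finset.sum_div, div_le_one (hw q hq)]
      exact hdisj q hq
    have h2 : (Tr.card : ℝ) ≤ (t : ℝ)^3 := by
      have : Tr.card ≤ t * (t * t) := by
        refine (Finset.card_filter_le _ _).trans ?_
        rw [Finset.card_product, Finset.card_product, hct]
      calc (Tr.card : ℝ) ≤ ((t * (t * t) : ℕ) : ℝ) := by exact_mod_cast this
        _ = _ := by push_cast; ring
    rw [div_lt_iff₀ hμ] at hm
    simp only [Finset.sum_const, nsmul_eq_mul, mul_one, hBm] at h1 ⊢
    linarith
  obtain ⟨b, hb, hbs⟩ := Finset.exists_le_of_sum_le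
    (Finset.card_pos.mp (by rw [hBm]; exact hm0)) htot
  refine ⟨b, hb, S', hSS, hct, ?_⟩
  intro i hi j hj k hk hij hik hjk
  have hq : (i, j, k) ∈ Tr := by simp [Tr, hi, hj, hk, hij, hik, hjk]
  have := (Finset.single_le_sum (f := fun q => ((E b q).card : ℝ) / w q)
    (fun q hq => div_nonneg (Nat.cast_nonneg _) (hw q hq).le) hq).trans hbs
  rw [div_le_iff₀ (hw _ hq)] at this
  exact this

/-- From bounds on neighbourhoods to a hole. -/
lemma hole_of {A : ReducedHG} {ε μ : ℝ} (hε : 0 < ε) (hA : A.EEDense (1/3 + ε))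
    {S J : Finset ℕ} (hS : S ⊆ A.I) (hJ : J ⊆ S) {b : ℕ} (hb : b ∈ A.I) (hbS : b ∉ S) (f : ℕ → ℕ)
    (hf : ∀ a ∈ S, f a ∈ A.P a b)
    (h : ∀ i ∈ J, ∀ j ∈ J, ∀ k ∈ J, i ≠ j → i ≠ k → j ≠ k →
      (A.ecount (A.nbhd i j (f i) (f j)) (A.nbhd i k (f i) (f k))
        (A.nbhd j k (f j) (f k)) : ℝ) ≤
      μ * (((A.P i j).card : ℝ) * ((A.P i k).card : ℝ) * ((A.P j k).card : ℝ))) :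
    A.IsHoleW μ (1/3 + ε) J (A.link S f) := by
  have hw : ∀ i ∈ J, ∀ j ∈ J, i ≠ j →
      (1/3 + ε) * ((A.P i j).card : ℝ) ≤ (((A.link S f ∩ A.P i j)).card : ℝ) := by
    intro i hi j hj hij
    rw [link_inter A S f (hJ hi) (hJ hj) hij]
    refine hA b i j hb (hS (hJ hi)) (hS (hJ hj)) (fun e => hbS (e ▸ hJ hi))
      (fun e => hbS (e ▸ hJ hj)) hij _ ?_ _ ?_
    · rw [A.Psymm]; exact hf i (hJ hi)
    · rw [A.Psymm]; exact hf j (hJ hj)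
  refine ⟨⟨?_, ?_⟩, hw⟩
  · intro i hi j hj hij
    have h1 := hw i hi j hj hij
    have h2 := Finset.card_pos.mpr (A.Pnonempty i j (hS (hJ hi)) (hS (hJ hj)) hij)
    rw [← Finset.card_pos]
    have : (0:ℝ) < (((A.link S f ∩ A.P i j)).card : ℝ) := lt_of_lt_of_le (by positivity) h1
    exact_mod_cast this
  · intro i hi j hj k hk hij hik hjk
    rw [link_inter A S f (hJ hi) (hJ hj) hij, link_inter A S f (hJ hi) (hJ hk) hik,
      link_inter A S f (hJ hj) (hJ hk) hjk]
    exact h i hi j hj k hk hij hik hjk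

/-- Selecting a transversal inside a hole whose link almost avoids the hole. -/
lemma select {A : ReducedHG} {ε μ : ℝ} (hε : 0 < ε) (hμ : 0 < μ) {S J : Finset ℕ} {Φ : Finset ℕ}
    (hJI : J ⊆ A.I)
    (hΦ : A.IsHoleW μ (1/3 + ε) J Φ) (hS : S ⊆ J) (hsm : (S.card : ℝ)^2 * (9 * μ / ε) < 1)
    {c : ℕ} (hc : c ∈ J) (hcS : c ∉ S) :
    ∃ f : ℕ → ℕ, (∀ a ∈ S, f a ∈ A.P a c) ∧ ∀ a ∈ S, ∀ a' ∈ S, a ≠ a' →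
      ((Φ ∩ A.nbhd a a' (f a) (f a')).card : ℝ) < ε * ((A.P a a').card : ℝ) := by
  have hca : ∀ a ∈ S, c ≠ a := fun a ha e => hcS (e ▸ ha)
  have hsel := union_sel (ι := S) (fun a => Φ ∩ A.P c a)
    (fun a => hΦ.1.1 c hc a (hS a.2) (hca a a.2))
    (fun a a' x y => ε * ((A.P a a').card : ℝ) ≤ ((Φ ∩ A.nbhd a a' x y).card : ℝ))
    (9 * μ / ε)
  have hsel2 := fun hh => hsel hh (by positivity) (by simpa using hsm)
  suffices hh : _ by
    obtain ⟨f, hf1, hf2⟩ := hsel2 hh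
    refine ⟨fun a => if h : a ∈ S then f ⟨a, h⟩ else 0, ?_, ?_⟩
    · intro a ha
      have := hf1 ⟨a, ha⟩
      rw [A.Psymm]
      simpa [ha] using (Finset.mem_inter.mp this).2
    · intro a ha a' ha' hne
      have := hf2 ⟨a, ha⟩ ⟨a', ha'⟩ (by simpa using hne)
      simpa [ha, ha'] using this
  · rintro ⟨a, ha⟩ ⟨a', ha'⟩ hne
    have hne : a ≠ a' := by simpa using hne
    dsimp only
    set Bd := (((Φ ∩ A.P c a) ×ˢ (Φ ∩ A.P c a')).filter fun p =>
      ε * ((A.P a a').card : ℝ) ≤ ((Φ ∩ A.nbhd a a' p.1 p.2).card : ℝ)) with hBd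
    have h1 := hΦ.1.2 c hc a (hS ha) a' (hS ha') (hca a ha) (hca a' ha') hne
    have h2 : ∑ p ∈ Bd, (Φ ∩ A.nbhd a a' p.1 p.2).card ≤
        A.ecount (Φ ∩ A.P c a) (Φ ∩ A.P c a') (Φ ∩ A.P a a') := by
      rw [← Finset.card_sigma]
      unfold ecount
      apply Finset.card_le_card_of_injOn (fun s => (s.1.1, s.1.2, s.2))
      · rintro ⟨⟨x, y⟩, z⟩ hs
        simp only [hBd, coe_sigma, Set.mem_sigma_iff, mem_coe, mem_filter, mem_product, mem_inter,
          mem_nbhd] at hs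
        simp only [coe_filter, Set.mem_ofPred_eq, mem_product, mem_inter]
        tauto
      · rintro ⟨⟨x, y⟩, z⟩ _ ⟨⟨x', y'⟩, z'⟩ _ h
        simp only [Prod.mk.injEq] at h
        obtain ⟨rfl, rfl, rfl⟩ := h
        rfl
    have h3 : (Bd.card : ℝ) * (ε * ((A.P a a').card : ℝ)) ≤
        ∑ p ∈ Bd, ((Φ ∩ A.nbhd a a' p.1 p.2).card : ℝ) := by
      rw [← nsmul_eq_mul]
      apply Finset.card_nsmul_le_sum
      intro p hp
      exact (Finset.mem_filter.mp hp).2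
    have h2' : ∑ p ∈ Bd, ((Φ ∩ A.nbhd a a' p.1 p.2).card : ℝ) ≤
        (A.ecount (Φ ∩ A.P c a) (Φ ∩ A.P c a') (Φ ∩ A.P a a') : ℝ) := by exact_mod_cast h2
    have hP : (0:ℝ) < ((A.P a a').card : ℝ) := by
      exact_mod_cast Finset.card_pos.mpr (A.Pnonempty a a' (hJI (hS ha)) (hJI (hS ha')) hne)
    have h4 : (Bd.card : ℝ) * ε ≤ μ * (((A.P c a).card : ℝ) * ((A.P c a').card : ℝ)) := by
      have := h3.trans (h2'.trans h1)
      refine le_of_mul_le_mul_right ?_ hP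
      linarith
    have w1 := hΦ.2 c hc a (hS ha) (hca a ha)
    have w2 := hΦ.2 c hc a' (hS ha') (hca a' ha')
    have w1' : ((A.P c a).card : ℝ) ≤ 3 * ((Φ ∩ A.P c a).card : ℝ) := by
      have : 0 ≤ ε * ((A.P c a).card : ℝ) := by positivity
      linarith
    have w2' : ((A.P c a').card : ℝ) ≤ 3 * ((Φ ∩ A.P c a').card : ℝ) := by
      have : 0 ≤ ε * ((A.P c a').card : ℝ) := by positivity
      linarith
    have h5 : ((A.P c a).card : ℝ) * ((A.P c a').card : ℝ) ≤
      (3 * ((Φ ∩ A.P c a).card : ℝ)) * (3 * ((Φ ∩ A.P c a').card : ℝ)) := by gcongr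
    rw [div_mul_eq_mul_div, le_div_iff₀ hε]
    have h6 := mul_le_mul_of_nonneg_left h5 hμ.le
    linarith

end ReducedHG

/-- Lemma (`lem:1247`): every sufficiently large `ε`-wicked reduced hypergraph contains,
on some set `J` of `t` indices, two `ε`-disjoint `(μ, 1/3+ε)`-holes. -/
theorem two_disjoint_holes_exist :
    ∀ (t : ℕ) (ε μ : ℝ), 0 < ε → 0 < μ → ∃ n₀ : ℕ,
      ∀ A : ReducedHG, n₀ ≤ A.I.card → A.Wicked ε →
        ∃ J ⊆ A.I, J.card = t ∧ ∃ Φ Ψ : Finset ℕ,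
          A.IsHoleW μ (1/3 + ε) J Φ ∧ A.IsHoleW μ (1/3 + ε) J Ψ ∧
          A.HolesDisjoint ε J Φ Ψ := by
  intro t ε μ hε hμ
  obtain ⟨m2, n2, H2⟩ := ReducedHG.main_lemma t μ hμ
  set μ1 : ℝ := min μ (ε / (9 * ((n2 : ℝ)^2 + 1))) with hμ1
  have hμ1p : 0 < μ1 := lt_min hμ (by positivity)
  obtain ⟨m1, n1, H1⟩ := ReducedHG.main_lemma (m2 + n2) μ1 hμ1p
  refine ⟨m1 + n1, ?_⟩
  intro A hI hA
  obtain ⟨B, hB, hBc⟩ := Finset.exists_subset_card_eq (show m1 ≤ A.I.card by omega)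
  have hT : ∀ a b, ∃ v, a ∈ A.I \ B → b ∈ B → v ∈ A.P a b := by
    intro a b
    by_cases h : a ∈ A.I \ B ∧ b ∈ B
    · have h1 := Finset.mem_sdiff.mp h.1
      obtain ⟨v, hv⟩ := A.Pnonempty a b h1.1 (hB h.2) (fun e => h1.2 (e ▸ h.2))
      exact ⟨v, fun _ _ => hv⟩
    · exact ⟨0, fun h1 h2 => absurd ⟨h1, h2⟩ h⟩
  choose T hT using hT
  obtain ⟨b, hb, S1, hS1, hS1c, h1⟩ := H1 A ε hε hA (A.I \ B) B Finset.sdiff_subset hB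
    Finset.sdiff_disjoint hBc (by rw [Finset.card_sdiff_of_subset hB]; omega) T
    (fun a ha b hb => hT a b ha hb)
  have hS1I : S1 ⊆ A.I := hS1.trans Finset.sdiff_subset
  have hbS1 : b ∉ S1 := fun h => (Finset.mem_sdiff.mp (hS1 h)).2 hb
  have hΦ := ReducedHG.hole_of hε hA.1 hS1I (Finset.Subset.refl S1) (hB hb) hbS1 (fun a => T a b)
    (fun a ha => hT a b (hS1 ha) hb) h1
  set Φ := A.link S1 (fun a => T a b) with hΦd
  obtain ⟨C, hC, hCc⟩ := Finset.exists_subset_card_eq (show m2 ≤ S1.card by omega)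
  have hS2c : (S1 \ C).card = n2 := by rw [Finset.card_sdiff_of_subset hC]; omega
  have hsm : (((S1 \ C).card : ℕ) : ℝ)^2 * (9 * μ1 / ε) < 1 := by
    rw [hS2c]
    have h : μ1 ≤ ε / (9 * ((n2 : ℝ)^2 + 1)) := min_le_right _ _
    rw [le_div_iff₀ (by positivity)] at h
    rw [← mul_div_assoc, div_lt_one hε]
    nlinarith
  have hU : ∀ c, ∃ f : ℕ → ℕ, c ∈ C → (∀ a ∈ S1 \ C, f a ∈ A.P a c) ∧
      ∀ a ∈ S1 \ C, ∀ a' ∈ S1 \ C, a ≠ a' →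
      ((Φ ∩ A.nbhd a a' (f a) (f a')).card : ℝ) < ε * ((A.P a a').card : ℝ) := by
    intro c
    by_cases hc : c ∈ C
    · obtain ⟨f, hf⟩ := ReducedHG.select hε hμ1p hS1I hΦ Finset.sdiff_subset hsm (hC hc)
        (fun h => (Finset.mem_sdiff.mp h).2 hc)
      exact ⟨f, fun _ => hf⟩
    · exact ⟨fun _ => 0, fun h => absurd h hc⟩
  choose U hU using hU
  obtain ⟨c, hc, J, hJ, hJc, h2⟩ := H2 A ε hε hA (S1 \ C) C (Finset.sdiff_subset.trans hS1I)
    (hC.trans hS1I) Finset.sdiff_disjoint hCc hS2c.ge (fun a c => U c a)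
    (fun a ha c hc => (hU c hc).1 a ha)
  have hJS : J ⊆ S1 := hJ.trans Finset.sdiff_subset
  have hJI : J ⊆ A.I := hJS.trans hS1I
  have hcJ : c ∉ J := fun h => (Finset.mem_sdiff.mp (hJ h)).2 hc
  have hΨ := ReducedHG.hole_of hε hA.1 hJI (Finset.Subset.refl J) (hS1I (hC hc)) hcJ (U c)
    (fun a ha => (hU c hc).1 a (hJ ha)) h2
  refine ⟨J, hJI, hJc, Φ, A.link J (U c), ?_, hΨ, ?_⟩
  · refine ReducedHG.hole_of hε hA.1 hS1I hJS (hB hb) hbS1 (fun a => T a b)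
      (fun a ha => hT a b (hS1 ha) hb) ?_
    intro i hi j hj k hk hij hik hjk
    refine (h1 i (hJS hi) j (hJS hj) k (hJS hk) hij hik hjk).trans ?_
    gcongr
    exact min_le_left _ _
  · intro i hi j hj hij
    rw [Finset.inter_assoc, ReducedHG.link_inter A J (U c) hi hj hij]
    exact (hU c hc).2 i (hJ hi) j (hJ hj) hij
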